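/- Let G be a finite simple graph on a vertex set V with at least 3 elements. Suppose that for every vertex v ∈ V there exist: a vertex v₀ ∈ V with v₀ ≠ v; a finite simple graph H on a vertex set W partitioned into two disjoint parts W₋ and W₊ with W₋ having at least 2 elements, such that H is doubly 2-connected with respect to (W₋, W₊), i.e., for every w₋ ∈ W₋ and every w₊ ∈ W₊ the subgraph of H induced on W \ {w₋, w₊} is connected; and a map f : W → V such that f is constantly equal to v₀ on W₋, f restricted to W₊ is a bijection onto V \ {v₀}, and for every edge {x, y} of H either f(x) = f(y) or {f(x), f(y)} is an edge of G. Then G is 2-connected, i.e., for every vertex v ∈ V the subgraph of G induced on V \ {v} is connected. -/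

import Mathlib

/-- A surjection sending each edge to an edge or a single vertex preserves connectedness. -/
theorem SimpleGraph.Connected.of_surjective_collapse {V W : Type*} {G : SimpleGraph V}
    {H : SimpleGraph W} (hH : H.Connected) (f : W → V) (hf : Function.Surjective f)
    (hadj : ∀ x y, H.Adj x y → f x = f y ∨ G.Adj (f x) (f y)) : G.Connected := by
  have hreach {x y : W} (p : H.Walk x y) : G.Reachable (f x) (f y) := by
    induction p with
    | nil => exact .rfl
    | cons h _ ih =>
      rcases hadj _ _ h with heq | hG
      · rwa [heq]
      · exact hG.reachable.trans ih
  have : Nonempty V := hH.nonempty.map f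
  refine ⟨fun a b => ?_⟩
  obtain ⟨x, rfl⟩ := hf a
  obtain ⟨y, rfl⟩ := hf b
  obtain ⟨p⟩ := hH.preconnected x y
  exact hreach p

/-- If a finite simple graph `G` on at least 3 vertices receives, for each
vertex `v`, a collapsing map from a doubly 2-connected graph `H` (with respect
to a partition `(W₋, W₊)` of its vertices, `W₋` having at least two elements)
which is constant equal to some `v₀ ≠ v` on `W₋` and restricts to a bijection
from `W₊` onto `V \ {v₀}`, sending edges to edges or collapsing them, then `G`
is 2-connected. -/
theorem two_connected_of_doubly_two_connected_collapse
    {V : Type*} [Fintype V] (G : SimpleGraph V) (hV : 3 ≤ Fintype.card V)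
    (hyp : ∀ v : V, ∃ (v₀ : V), v₀ ≠ v ∧
      ∃ (W : Type) (_ : Fintype W) (H : SimpleGraph W)
        (Wm Wp : Set W) (f : W → V),
        Wm ∪ Wp = Set.univ ∧ Wm ∩ Wp = ∅ ∧
        2 ≤ Wm.ncard ∧
        (∀ wm ∈ Wm, ∀ wp ∈ Wp,
          (H.induce {x | x ≠ wm ∧ x ≠ wp}).Connected) ∧
        (∀ w ∈ Wm, f w = v₀) ∧
        Set.BijOn f Wp {u | u ≠ v₀} ∧
        (∀ x y, H.Adj x y → f x = f y ∨ G.Adj (f x) (f y))) :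
    ∀ v : V, (G.induce {u | u ≠ v}).Connected := by
  intro v
  obtain ⟨v₀, hv₀, W, _, H, Wm, Wp, f, hunion, hdisj, hcard, hconn, hfm, hbij, hadj⟩ := hyp v
  obtain ⟨a, ha, b, hb, hab⟩ := (Set.one_lt_ncard (s := Wm)).1 hcard
  obtain ⟨p, hp, rfl⟩ := hbij.surjOn (show v ∈ {u | u ≠ v₀} from hv₀.symm)
  have hne_of_mem {x y : W} (hx : x ∈ Wm) (hy : y ∈ Wp) : x ≠ y := by
    rintro rfl
    exact (hdisj ▸ Set.mem_inter hx hy : x ∈ (∅ : Set W))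
  have hmaps (x : W) (hx : x ≠ p) : f x ≠ f p := by
    rcases (hunion ▸ Set.mem_univ x : x ∈ Wm ∪ Wp) with hxm | hxp
    · rwa [hfm x hxm]
    · exact fun h => hx (hbij.injOn hxp hp h)
  refine (hconn a ha p hp).of_surjective_collapse
    (fun x => ⟨f x, hmaps x x.2.2⟩) ?_ ?_
  · rintro ⟨u, hu⟩
    by_cases huv : u = v₀
    · exact ⟨⟨b, hab.symm, hne_of_mem hb hp⟩, Subtype.ext ((hfm b hb).trans huv.symm)⟩
    · obtain ⟨w, hw, rfl⟩ := hbij.surjOn (show u ∈ {u | u ≠ v₀} from huv)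
      refine ⟨⟨w, (hne_of_mem ha hw).symm, ?_⟩, rfl⟩
      rintro rfl
      exact hu rfl
  · intro x y hxy
    exact (hadj x y hxy).imp Subtype.ext id
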